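/- In the quantum shuffle algebra with diagonal braiding, the elements X_a := v_{p₁}^{·n₁} · ⋯ · v_{p_s}^{·n_s} (quantum shuffle products over the Lyndon factorization a = p₁^{n₁}⋯p_s^{n_s}) satisfy a triangular change of basis: X_a = Σ_{b ≥ a} α_{ab} v_b with leading coefficient α_{aa} = Π_{j=1}^{s} [n_j]_{Q_j}!, where Q_j = Π_{k,l} q-factor of the letters of p_j. In particular, if no Q_j is a nontrivial root of unity of order ≤ n_j (so each [n_j]_{Q_j}! ≠ 0), the X_a for a ∈ S(u) form a basis of the content-graded component T(V)(u). -/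

import Mathlib

open scoped Classical

/-- Lexicographic strict order on words, with the convention that a word is
strictly greater than each of its proper prefixes (i.e. `a ++ b < a`). -/
def wlt {X : Type*} [LinearOrder X] : List X → List X → Prop
  | [], _ => False
  | _ :: _, [] => True
  | x :: xs, y :: ys => x < y ∨ (x = y ∧ wlt xs ys)

/-- A nonempty word `p` is a Lyndon word if every proper nonempty suffix of `p`
is strictly less than `p`. -/
def IsLyndon {X : Type*} [LinearOrder X] (p : List X) : Prop :=
  p ≠ [] ∧ ∀ u v : List X, u ≠ [] → v ≠ [] → p = u ++ v → wlt v p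

/-- `w` is a `(p, n-p)`-shuffle. -/
def IsPQShuffle (p : ℕ) {n : ℕ} (w : Equiv.Perm (Fin n)) : Prop :=
  ∀ i j : Fin n, (i : ℕ) < (j : ℕ) → (((j : ℕ) < p) ∨ (p ≤ (i : ℕ))) →
    w i < w j

/-- Quantum shuffle product of two basis words for the diagonal braiding
`σ(e_i ⊗ e_j) = q_{ij}(e_j ⊗ e_i)`: the sum over all `(p, n-p)`-shuffles `w`
of the Matsumoto lift `T_w` applied to `a ++ b`, i.e. the shuffled word with
coefficient `Π q_{x_i x_j}` over the inversions of `w`. -/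
noncomputable def qMulWord {k : Type*} [Field k] {X : Type*} (q : X → X → k)
    (a b : List X) : (List X) →₀ k :=
  ∑ w : Equiv.Perm (Fin (a.length + b.length)),
    if IsPQShuffle a.length w then
      (∏ ij : Fin (a.length + b.length) × Fin (a.length + b.length),
          if (ij.1 : ℕ) < (ij.2 : ℕ) ∧ w ij.2 < w ij.1 then
            q ((a ++ b).get (Fin.cast (by simp) ij.1))
              ((a ++ b).get (Fin.cast (by simp) ij.2))
          else 1) •
        Finsupp.single
          (List.ofFn fun j : Fin (a.length + b.length) =>
            (a ++ b).get (Fin.cast (by simp) (w.symm j))) (1 : k)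
    else 0

/-- The quantum shuffle product on `T(V)`, extended bilinearly. -/
noncomputable def qShMul {k : Type*} [Field k] {X : Type*} (q : X → X → k)
    (f g : (List X) →₀ k) : (List X) →₀ k :=
  f.sum fun a ca => g.sum fun b cb => (ca * cb) • qMulWord q a b

/-- The q-factorial `[n]_Q! = Π_{j=1}^{n} (1 + Q + ⋯ + Q^{j-1})`. -/
def qFact {k : Type*} [Field k] (n : ℕ) (Q : k) : k :=
  ∏ j ∈ Finset.range n, ∑ i ∈ Finset.range (j + 1), Q ^ i

/-- `Q_p = Π_{k,l} q_{x_k x_l}` over the letters of the word `p`. -/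
def Qof {k : Type*} [Field k] {X : Type*} (q : X → X → k) (p : List X) : k :=
  ∏ i : Fin p.length, ∏ j : Fin p.length, q (p.get i) (p.get j)

/-- `X_a` built from a factor list `fs` of Lyndon words: the iterated quantum
shuffle product `v_{p₁} · v_{p₂} · ⋯`. -/
noncomputable def XOf {k : Type*} [Field k] {X : Type*} (q : X → X → k)
    (fs : List (List X)) : (List X) →₀ k :=
  (fs.map fun p => Finsupp.single p (1 : k)).foldr (qShMul q)
    (Finsupp.single [] 1)


/-- The factor `∏_{x ∈ a} q_{x y}` picked up when the letter `y` crosses the word `a`. -/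
def crossFactor {k X : Type*} [Field k] (q : X → X → k) (a : List X) (y : X) : k :=
  (a.map fun x => q x y).prod

/-- The coefficient of the word `c` in the quantum shuffle product of the words `a` and `b`,
by recursion on the first letter of `c`. -/
noncomputable def shCoeff {k X : Type*} [Field k] (q : X → X → k) :
    List X → List X → List X → k
  | a, b, [] => if a = [] ∧ b = [] then 1 else 0
  | a, b, z :: c =>
    (match a with
      | [] => 0
      | x :: a' => if x = z then shCoeff q a' b c else 0) +
    (match b with
      | [] => 0
      | y :: b' => if y = z then crossFactor q a y * shCoeff q a b' c else 0)

/-- The coefficient of `c` in the sum over `(p, n-p)`-shuffles of the letters `f`. -/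
noncomputable def shuffleSum {k X : Type*} [Field k] (q : X → X → k) (p n : ℕ)
    (f : Fin n → X) (c : List X) : k :=
  ∑ w : Equiv.Perm (Fin n), if IsPQShuffle p w then
    (∏ ij : Fin n × Fin n, if (ij.1 : ℕ) < (ij.2 : ℕ) ∧ w ij.2 < w ij.1 then
      q (f ij.1) (f ij.2) else 1) *
    (if List.ofFn (fun j => f (w.symm j)) = c then 1 else 0) else 0

theorem qMulWord_apply_eq_shuffleSum {k X : Type*} [Field k] (q : X → X → k)
    (a b c : List X) :
    qMulWord q a b c = shuffleSum q a.length (a.length + b.length)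
      (fun i => (a ++ b).get (Fin.cast (by simp) i)) c := by
  unfold qMulWord shuffleSum
  rw [Finsupp.finsetSum_apply]
  refine Finset.sum_congr rfl fun w _ => ?_
  split_ifs with h h'
  · rw [Finsupp.smul_apply, Finsupp.single_apply, if_pos h', smul_eq_mul]
  · rw [Finsupp.smul_apply, Finsupp.single_apply, if_neg h', smul_eq_mul]
  · rfl

/-- The permutation sending `i` to `0` and acting as `σ` on the remaining points. -/
def permExtend {n : ℕ} (i : Fin (n + 1)) (σ : Equiv.Perm (Fin n)) :
    Equiv.Perm (Fin (n + 1)) :=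
  (finSuccEquiv' i).trans ((Equiv.optionCongr σ).trans (finSuccEquiv' 0).symm)

theorem permExtend_self {n : ℕ} (i : Fin (n + 1)) (σ : Equiv.Perm (Fin n)) :
    permExtend i σ i = 0 := by
  simp [permExtend]

theorem permExtend_succAbove {n : ℕ} (i : Fin (n + 1)) (σ : Equiv.Perm (Fin n)) (j : Fin n) :
    permExtend i σ (i.succAbove j) = (σ j).succ := by
  simp [permExtend]

theorem permExtend_symm_zero {n : ℕ} (i : Fin (n + 1)) (σ : Equiv.Perm (Fin n)) :
    (permExtend i σ).symm 0 = i := by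
  rw [Equiv.symm_apply_eq, permExtend_self]

theorem permExtend_symm_succ {n : ℕ} (i : Fin (n + 1)) (σ : Equiv.Perm (Fin n)) (j : Fin n) :
    (permExtend i σ).symm j.succ = i.succAbove (σ.symm j) := by
  rw [Equiv.symm_apply_eq, permExtend_succAbove, Equiv.apply_symm_apply]

theorem permExtend_bijective (n : ℕ) :
    Function.Bijective fun x : Fin (n + 1) × Equiv.Perm (Fin n) => permExtend x.1 x.2 := by
  rw [Fintype.bijective_iff_injective_and_card]
  constructor
  · rintro ⟨i, σ⟩ ⟨j, τ⟩ h
    simp only at h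
    have hij : i = j := by
      rw [← permExtend_symm_zero i σ, h, permExtend_symm_zero]
    subst hij
    have : σ = τ := by
      ext1 x
      have := permExtend_succAbove i σ x
      rw [h, permExtend_succAbove] at this
      exact (Fin.succ_injective _ this).symm
    rw [this]
  · simp [Fintype.card_perm, Nat.factorial_succ]

theorem isPQShuffle_permExtend_iff {n p : ℕ} (hp : p ≤ n + 1) (i : Fin (n + 1))
    (σ : Equiv.Perm (Fin n)) :
    IsPQShuffle p (permExtend i σ) ↔ ((i : ℕ) = 0 ∨ (i : ℕ) = p) ∧
      IsPQShuffle (if (i : ℕ) < p then p - 1 else p) σ := by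
  have hval : ∀ j : Fin n, ((i.succAbove j : Fin (n + 1)) : ℕ) =
      if (j : ℕ) < i then (j : ℕ) else j + 1 := by
    intro j
    simp only [Fin.succAbove, Fin.lt_def, Fin.val_castSucc]
    split_ifs <;> simp
  constructor
  · intro h
    have hi : (i : ℕ) = 0 ∨ (i : ℕ) = p := by
      by_contra! hne
      obtain ⟨h0, h1⟩ := hne
      by_cases hlt : (i : ℕ) < p
      · have := h 0 i (by rw [Fin.val_zero]; omega) (Or.inl hlt)
        simp [permExtend_self] at this
      · have := h ⟨p, by omega⟩ i (by simp; omega) (Or.inr (by simp))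
        simp [permExtend_self] at this
    refine ⟨hi, fun a b hab hc => ?_⟩
    have := h (i.succAbove a) (i.succAbove b) (by rw [hval, hval]; split_ifs <;> omega)
      (by rw [hval, hval]; split_ifs at hc ⊢ <;> omega)
    simpa [permExtend_succAbove] using this
  · rintro ⟨hi, h⟩ a b hab hc
    rcases Fin.eq_self_or_eq_succAbove i a with rfl | ⟨a, rfl⟩
    · rcases Fin.eq_self_or_eq_succAbove a b with rfl | ⟨b, rfl⟩
      · omega
      · simp [permExtend_succAbove, permExtend_self]
    · rcases Fin.eq_self_or_eq_succAbove i b with rfl | ⟨b, rfl⟩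
      · omega
      · rw [permExtend_succAbove, permExtend_succAbove, Fin.succ_lt_succ_iff]
        rw [hval, hval] at hab hc
        apply h <;> split_ifs at hab hc ⊢ <;> omega

theorem shuffleSum_cons {k X : Type*} [Field k] (q : X → X → k) {p n : ℕ} (hp : p ≤ n + 1)
    (f : Fin (n + 1) → X) (z : X) (c : List X) :
    shuffleSum q p (n + 1) f (z :: c) = ∑ i : Fin (n + 1),
      if ((i : ℕ) = 0 ∨ (i : ℕ) = p) ∧ f i = z then
        (∏ a : Fin n, if i.succAbove a < i then q (f (i.succAbove a)) (f i) else 1) *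
          shuffleSum q (if (i : ℕ) < p then p - 1 else p) n (fun j => f (i.succAbove j)) c
      else 0 := by
  conv_lhs => unfold shuffleSum
  rw [← (permExtend_bijective n).sum_comp, Fintype.sum_prod_type]
  refine Finset.sum_congr rfl fun i _ => ?_
  simp only [isPQShuffle_permExtend_iff hp]
  have hword : ∀ σ : Equiv.Perm (Fin n),
      (List.ofFn (fun j => f ((permExtend i σ).symm j)) = z :: c) ↔
        f i = z ∧ List.ofFn (fun j => f (i.succAbove (σ.symm j))) = c := by
    intro σ
    rw [List.ofFn_succ, List.cons_eq_cons]
    simp only [permExtend_symm_zero, permExtend_symm_succ]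
  have hprod : ∀ σ : Equiv.Perm (Fin n),
      (∏ ij : Fin (n + 1) × Fin (n + 1), if (ij.1 : ℕ) < (ij.2 : ℕ) ∧
          permExtend i σ ij.2 < permExtend i σ ij.1 then q (f ij.1) (f ij.2) else 1) =
        (∏ a : Fin n, if i.succAbove a < i then q (f (i.succAbove a)) (f i) else 1) *
        ∏ ij : Fin n × Fin n, if (ij.1 : ℕ) < (ij.2 : ℕ) ∧ σ ij.2 < σ ij.1 then
          q (f (i.succAbove ij.1)) (f (i.succAbove ij.2)) else 1 := by
    intro σ
    rw [Fintype.prod_prod_type, Fintype.prod_prod_type, Fin.prod_univ_succAbove _ i]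
    simp only [permExtend_self, Fin.not_lt_zero, and_false, if_false, Finset.prod_const_one,
      one_mul]
    rw [← Finset.prod_mul_distrib]
    refine Finset.prod_congr rfl fun a _ => ?_
    rw [Fin.prod_univ_succAbove _ i]
    simp only [permExtend_self, permExtend_succAbove, Fin.succ_lt_succ_iff, Fin.succ_pos,
      and_true, ← Fin.lt_def, Fin.succAbove_lt_succAbove_iff]
  simp only [hword, hprod]
  unfold shuffleSum
  by_cases h1 : ((i : ℕ) = 0 ∨ (i : ℕ) = p)
  · by_cases h2 : f i = z
    · simp only [h1, h2, true_and, and_self, if_true]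
      rw [Finset.mul_sum]
      refine Finset.sum_congr rfl fun σ _ => ?_
      split_ifs <;> simp
    · simp [h2]
  · simp only [h1, false_and, if_false, Finset.sum_const_zero]

theorem Fin.prod_ite_val_lt {M : Type*} [CommMonoid M] {N m r : ℕ} (h : N = m + r)
    (g : Fin N → M) :
    (∏ j : Fin N, if (j : ℕ) < m then g j else 1) = ∏ j : Fin m, g ⟨j, by omega⟩ := by
  subst h
  rw [Fin.prod_univ_add]
  simp [Fin.castAdd, Fin.castLE]

theorem shuffleSum_eq_shCoeff {k X : Type*} [Field k] (q : X → X → k) (c : List X) :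
    ∀ (a b : List X) (n : ℕ) (f : Fin n → X), n = a.length + b.length →
      (∀ i : Fin n, (a ++ b)[(i : ℕ)]? = some (f i)) →
      shuffleSum q a.length n f c = shCoeff q a b c := by
  induction c with
  | nil =>
    intro a b n f hn hf
    rw [shCoeff]
    cases n with
    | zero =>
      have ha : a = [] := List.eq_nil_of_length_eq_zero (by omega)
      have hb : b = [] := List.eq_nil_of_length_eq_zero (by omega)
      subst ha hb
      simp [shuffleSum, IsPQShuffle]
    | succ n =>
      have : ¬ (a = [] ∧ b = []) := by
        rintro ⟨rfl, rfl⟩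
        simp at hn
      simp [shuffleSum, this]
  | cons z c ih =>
    intro a b n f hn hf
    cases n with
    | zero =>
      have ha : a = [] := List.eq_nil_of_length_eq_zero (by omega)
      have hb : b = [] := List.eq_nil_of_length_eq_zero (by omega)
      subst ha hb
      simp [shuffleSum, shCoeff]
    | succ n =>
      have hright : ∀ (y : X) (b' : List X) (i : Fin (n + 1)), b = y :: b' →
          (i : ℕ) = a.length → f i = y ∧
          (∏ j : Fin n, if i.succAbove j < i then q (f (i.succAbove j)) (f i) else 1) *
          shuffleSum q (if (i : ℕ) < a.length then a.length - 1 else a.length) n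
            (fun j => f (i.succAbove j)) c = crossFactor q a y * shCoeff q a b' c := by
        rintro y b' i rfl hi
        have hfi : f i = y := by
          have := hf i
          rw [hi] at this
          simpa using this.symm
        refine ⟨hfi, ?_⟩
        rw [if_neg (by omega)]
        congr 1
        · have hlist : a = List.ofFn fun j : Fin a.length => f ⟨j, by omega⟩ := by
            refine List.ext_getElem (by simp) fun m h1 h2 => ?_
            have := hf ⟨m, by omega⟩
            simp only [List.getElem_ofFn]
            simpa [List.getElem?_append_left h1, List.getElem?_eq_getElem h1] using this
          rw [crossFactor, hlist, List.map_ofFn, List.prod_ofFn]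
          have := Fin.prod_univ_succAbove (fun j => if j < i then q (f j) (f i) else 1) i
          simp only [lt_irrefl, if_false, one_mul] at this
          rw [← this]
          simp only [Fin.lt_def, hi, hfi, Function.comp_def]
          exact Fin.prod_ite_val_lt (r := b'.length + 1) (by simpa using hn) _
        · apply ih
          · simp at hn; omega
          · intro j
            rw [← hf]
            simp only [Fin.succAbove, Fin.lt_def, Fin.val_castSucc, hi]
            split_ifs with hj
            · simp [List.getElem?_append_left hj]
            · rw [List.getElem?_append_right (by omega), List.getElem?_append_right (by simp; omega)]
              simp only [Fin.val_succ]
              rw [show (j : ℕ) + 1 - a.length = (j - a.length) + 1 by omega,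
                List.getElem?_cons_succ]
      rw [shuffleSum_cons q (by omega), Fin.sum_univ_succ]
      cases a with
      | nil =>
        cases b with
        | nil => simp at hn
        | cons y b' =>
          obtain ⟨h1, h2⟩ := hright y b' 0 rfl rfl
          rw [h2, h1]
          simp [shCoeff]
      | cons x a' =>
        have hf0 : f 0 = x := by
          have := hf 0
          simpa using this.symm
        have hleft : shuffleSum q a'.length n (fun j => f ((0 : Fin (n + 1)).succAbove j)) c =
            shCoeff q a' b c := by
          refine ih _ _ _ _ (by simp at hn; omega) fun j => ?_
          rw [← hf]
          simp
        have hfirst : (if (((0 : Fin (n + 1)) : ℕ) = 0 ∨ ((0 : Fin (n + 1)) : ℕ) =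
              (x :: a').length) ∧ f 0 = z then
            (∏ j : Fin n, if (0 : Fin (n + 1)).succAbove j < 0 then
              q (f ((0 : Fin (n + 1)).succAbove j)) (f 0) else 1) *
            shuffleSum q (if ((0 : Fin (n + 1)) : ℕ) < (x :: a').length then
              (x :: a').length - 1 else (x :: a').length) n
              (fun j => f ((0 : Fin (n + 1)).succAbove j)) c else 0) =
            if x = z then shCoeff q a' b c else 0 := by
          rw [← hleft, hf0]
          simp
        rw [hfirst]
        cases b with
        | nil =>
          rw [Finset.sum_eq_zero]
          · simp [shCoeff]
          · intro j _
            rw [if_neg]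
            have := j.2
            simp at hn ⊢
            omega
        | cons y b' =>
          have hlen : a'.length < n := by simp at hn; omega
          obtain ⟨h1, h2⟩ := hright y b' (Fin.succ ⟨a'.length, hlen⟩) rfl (by simp)
          rw [Finset.sum_eq_single ⟨a'.length, hlen⟩]
          · rw [h2, h1]
            simp [shCoeff]
          · intro j _ hj
            rw [if_neg]
            rintro ⟨h | h, -⟩
            · simp at h
            · apply hj
              ext
              simpa using h
          · simp

theorem qMulWord_apply {k X : Type*} [Field k] (q : X → X → k) (a b c : List X) :
    qMulWord q a b c = shCoeff q a b c := by
  rw [qMulWord_apply_eq_shuffleSum]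
  refine shuffleSum_eq_shCoeff q c a b _ _ rfl fun i => ?_
  simp

theorem wlt_append_left_iff {X : Type*} [LinearOrder X] (t a b : List X) :
    wlt (t ++ a) (t ++ b) ↔ wlt a b := by
  induction t with
  | nil => rfl
  | cons x t ih => simp [wlt, ih]

theorem wlt_irrefl {X : Type*} [LinearOrder X] (a : List X) : ¬ wlt a a := by
  induction a with
  | nil => simp [wlt]
  | cons x a ih => simp [wlt, ih]

theorem wlt_trans {X : Type*} [LinearOrder X] :
    ∀ {a b c : List X}, wlt a b → wlt b c → wlt a c
  | [], _, _, h, _ => by simp [wlt] at h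
  | _ :: _, [], _, _, h => by simp [wlt] at h
  | _ :: _, _ :: _, [], _, _ => by simp [wlt]
  | x :: a, y :: b, z :: c, h₁, h₂ => by
    simp only [wlt] at h₁ h₂ ⊢
    rcases h₁ with h₁ | ⟨rfl, h₁⟩
    · rcases h₂ with h₂ | ⟨rfl, h₂⟩
      · exact Or.inl (h₁.trans h₂)
      · exact Or.inl h₁
    · rcases h₂ with h₂ | ⟨rfl, h₂⟩
      · exact Or.inl h₂
      · exact Or.inr ⟨rfl, wlt_trans h₁ h₂⟩

theorem wlt_trichotomy {X : Type*} [LinearOrder X] :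
    ∀ a b : List X, wlt a b ∨ a = b ∨ wlt b a
  | [], [] => by simp
  | _ :: _, [] => by simp [wlt]
  | [], _ :: _ => by simp [wlt]
  | x :: a, y :: b => by
    rcases lt_trichotomy x y with h | rfl | h
    · exact Or.inl (Or.inl h)
    · rcases wlt_trichotomy a b with h | rfl | h
      · exact Or.inl (Or.inr ⟨rfl, h⟩)
      · exact Or.inr (Or.inl rfl)
      · exact Or.inr (Or.inr (Or.inr ⟨rfl, h⟩))
    · exact Or.inr (Or.inr (Or.inl h))

/-- Extending the larger word keeps the inequality, unless that word is a prefix of the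
smaller one. -/
theorem wlt_append_or {X : Type*} [LinearOrder X] :
    ∀ {a b : List X} (c : List X), wlt a b → wlt a (b ++ c) ∨ ∃ s, s ≠ [] ∧ a = b ++ s
  | [], _, _, h => by simp [wlt] at h
  | x :: a, [], _, _ => Or.inr ⟨x :: a, by simp⟩
  | x :: a, y :: b, c, h => by
    simp only [wlt] at h
    rcases h with h | ⟨rfl, h⟩
    · exact Or.inl (Or.inl h)
    · rcases wlt_append_or c h with h | ⟨s, hs, rfl⟩
      · exact Or.inl (Or.inr ⟨rfl, h⟩)
      · exact Or.inr ⟨s, hs, rfl⟩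

/-- When the smaller word is not longer, the two words differ at some letter of it. -/
theorem exists_getElem_lt_of_wlt {X : Type*} [LinearOrder X] :
    ∀ {a b : List X}, wlt a b → a.length ≤ b.length →
      ∃ d : ℕ, (∀ t < d, a[t]? = b[t]?) ∧ ∃ x y, a[d]? = some x ∧ b[d]? = some y ∧ x < y
  | [], _, h, _ => by simp [wlt] at h
  | _ :: _, [], _, h => by simp at h
  | x :: a, y :: b, h, hl => by
    simp only [wlt] at h
    rcases h with h | ⟨rfl, h⟩
    · exact ⟨0, by simp, x, y, by simpa using h⟩
    · obtain ⟨d, h1, x', y', h2⟩ := exists_getElem_lt_of_wlt h (by simpa using hl)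
      refine ⟨d + 1, fun t ht => ?_, x', y', by simpa using h2⟩
      cases t with
      | zero => simp
      | succ t => simpa using h1 t (by omega)

/-- `ReadsPrefix P h e f`: some shuffle of the factors `P h ⋯ P (h + e - 1)` and
`P 0 ⋯ P (f - 1)` of the sequence `P` is the factor `P h ⋯ P (h + e + f - 1)`. -/
inductive ReadsPrefix {X : Type*} (P : ℕ → X) (h : ℕ) : ℕ → ℕ → Prop
  | zero : ReadsPrefix P h 0 0
  | left {e f : ℕ} : ReadsPrefix P h e f → P (h + e) = P (h + e + f) →
      ReadsPrefix P h (e + 1) f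
  | right {e f : ℕ} : ReadsPrefix P h e f → P f = P (h + e + f) →
      ReadsPrefix P h e (f + 1)

namespace ReadsPrefix

variable {X : Type*} {P : ℕ → X}

theorem first_step {e f : ℕ} (H : ReadsPrefix P 0 e f) :
    (e = 0 ∧ f = 0) ∨ (∃ e', e = e' + 1 ∧ ReadsPrefix P 1 e' f) ∨
      ∃ f', f = f' + 1 ∧ ReadsPrefix P 1 f' e := by
  induction H with
  | zero => simp
  | @left e f _ heq ih =>
    rcases ih with ⟨rfl, rfl⟩ | ⟨e', rfl, h⟩ | ⟨f', rfl, h⟩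
    · exact Or.inr (Or.inl ⟨0, rfl, .zero⟩)
    · refine Or.inr (Or.inl ⟨e' + 1, rfl, h.left ?_⟩)
      convert heq using 2 <;> omega
    · refine Or.inr (Or.inr ⟨f', rfl, h.right ?_⟩)
      convert heq using 2 <;> omega
  | @right e f _ heq ih =>
    rcases ih with ⟨rfl, rfl⟩ | ⟨e', rfl, h⟩ | ⟨f', rfl, h⟩
    · exact Or.inr (Or.inr ⟨0, rfl, .zero⟩)
    · refine Or.inr (Or.inl ⟨e', rfl, h.right ?_⟩)
      convert heq using 2; omega
    · refine Or.inr (Or.inr ⟨f' + 1, rfl, h.left ?_⟩)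
      convert heq using 2 <;> omega

theorem unshift {h e f : ℕ} (H : ReadsPrefix P h e f)
    (hP : ∀ t < e + f, P (h + t) = P t) : ReadsPrefix P 0 e f := by
  induction H with
  | zero => exact .zero
  | @left e f _ heq ih =>
    refine (ih fun t ht => hP t (by omega)).left ?_
    rw [Nat.zero_add, ← hP e (by omega), heq, ← hP (e + f) (by omega), Nat.add_assoc]
  | @right e f _ heq ih =>
    refine (ih fun t ht => hP t (by omega)).right ?_
    rw [Nat.zero_add, heq, ← hP (e + f) (by omega), Nat.add_assoc]

variable [LinearOrder X]

theorem split {h d N : ℕ} (hP : ∀ t < d, P (h + t) = P t) (hd : P (h + d) < P d)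
    (hle : ∀ e f, e + f = d → e + f < N → ReadsPrefix P 0 e f →
      P (e + f) ≤ P e ∧ P (e + f) ≤ P f)
    {e f : ℕ} (H : ReadsPrefix P h e f) (hN : e + f ≤ N) :
    e + f ≤ d ∨ ∃ e', e = d + 1 + e' ∧ ReadsPrefix P (h + d + 1) e' f := by
  induction H with
  | zero => simp
  | @left e f H' heq ih =>
    rcases ih (by omega) with h1 | ⟨e', rfl, h1⟩
    · rcases h1.lt_or_eq with h2 | h2
      · left; omega
      · have h3 := hle e f h2 (by omega) (H'.unshift fun t ht => hP t (by omega))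
        rcases Nat.eq_zero_or_pos f with rfl | hf
        · exact Or.inr ⟨0, by omega, .zero⟩
        · rw [Nat.add_assoc, h2, hP e (by omega)] at heq
          rw [h2] at h3
          exact absurd (h3.1.trans heq.le) (not_le.2 hd)
    · refine Or.inr ⟨e' + 1, by omega, h1.left ?_⟩
      convert heq using 2 <;> omega
  | @right e f H' heq ih =>
    rcases ih (by omega) with h1 | ⟨e', rfl, h1⟩
    · rcases h1.lt_or_eq with h2 | h2
      · left; omega
      · have h3 := hle e f h2 (by omega) (H'.unshift fun t ht => hP t (by omega))
        rw [Nat.add_assoc, h2] at heq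
        rw [h2] at h3
        exact absurd (h3.2.trans heq.le) (not_le.2 hd)
    · refine Or.inr ⟨e', by omega, h1.right ?_⟩
      convert heq using 2; omega

/-- If every shift of `P` is at most `P`, then after reading a factor of `P` from two of its
factors, both available letters are at least the next letter of `P`. -/
theorem next_le
    (hP : ∀ k, (∀ t, P (k + t) = P t) ∨ ∃ d, (∀ t < d, P (k + t) = P t) ∧ P (k + d) < P d)
    (N : ℕ) : ∀ h e f, e + f = N → ReadsPrefix P h e f →
      P (h + e + f) ≤ P (h + e) ∧ P (h + e + f) ≤ P f := by
  induction N using Nat.strong_induction_on with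
  | _ N ih =>
    have base : ∀ e f, e + f = N → ReadsPrefix P 0 e f →
        P (e + f) ≤ P e ∧ P (e + f) ≤ P f := by
      intro e f hN H
      rcases H.first_step with ⟨rfl, rfl⟩ | ⟨e', rfl, h1⟩ | ⟨f', rfl, h1⟩
      · simp
      · have := ih (e' + f) (by omega) 1 e' f rfl h1
        rwa [Nat.add_comm 1 e'] at this
      · have := ih (f' + e) (by omega) 1 f' e rfl h1
        rw [Nat.add_comm 1 f', Nat.add_comm _ e] at this
        exact this.symm
    intro h e f hN H
    by_cases hall : ∀ t ≤ e + f, P (h + t) = P t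
    · have := base e f hN (H.unshift fun t ht => hall t ht.le)
      rwa [Nat.add_assoc, hall _ le_rfl, hall e (by omega)]
    · rcases hP h with h0 | ⟨d, h1, h2⟩
      · exact absurd (fun t _ => h0 t) hall
      have hd : d ≤ e + f := by
        by_contra hlt
        exact hall fun t ht => h1 t (by omega)
      rcases H.split h1 h2 (N := N) (fun e f _ hlt H => by
        simpa using ih _ hlt 0 e f rfl H) hN.le with h3 | ⟨e', rfl, h3⟩
      · have hd : e + f = d := by omega
        have h4 := base e f hN (H.unshift fun t ht => h1 t (by omega))
        rw [Nat.add_assoc, hd]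
        rw [hd] at h4
        refine ⟨?_, h2.le.trans h4.2⟩
        rcases Nat.eq_zero_or_pos f with rfl | hf
        · rw [← hd, Nat.add_zero]
        · rw [h1 e (by omega)]
          exact h2.le.trans h4.1
      · have := ih (e' + f) (by omega) _ e' f rfl h3
        rwa [show h + (d + 1 + e') = h + d + 1 + e' by omega]

theorem not_full_period {n : ℕ} (hper : ∀ t, P (n + t) = P t)
    (hP : ∀ k, (∀ t, P (k + t) = P t) ∨ ∃ d, (∀ t < d, P (k + t) = P t) ∧ P (k + d) < P d)
    {e f : ℕ} (he : ∃ d, (∀ t < d, P (e + t) = P t) ∧ P (e + d) < P d)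
    (hn : e + f = n) : ¬ ReadsPrefix P 0 e f := by
  intro H
  obtain ⟨d, h1, h2⟩ := he
  have key : ∀ m ≤ d, ReadsPrefix P 0 (e + m) f := by
    intro m
    induction m with
    | zero => exact fun _ => H
    | succ m ih =>
      intro hm
      refine (ih (by omega)).left ?_
      rw [Nat.zero_add, h1 m (by omega), ← hper m, ← hn]
      congr 1; omega
  have := (next_le hP _ 0 _ _ rfl (key d le_rfl)).1
  rw [Nat.zero_add, show e + d + f = n + d by omega, hper] at this
  exact absurd this (not_le.2 h2)

end ReadsPrefix

theorem IsLyndon.suffix_wlt {X : Type*} [LinearOrder X] {p : List X} (hp : IsLyndon p)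
    {r : ℕ} (h0 : 0 < r) (hr : r < p.length) : wlt (p.drop r) p := by
  refine hp.2 (p.take r) (p.drop r) ?_ ?_ (List.take_append_drop r p).symm
  · rw [← List.length_pos_iff, List.length_take]; omega
  · rw [← List.length_pos_iff, List.length_drop]; omega

theorem IsLyndon.length_pos {X : Type*} [LinearOrder X] {p : List X} (hp : IsLyndon p) :
    0 < p.length :=
  List.length_pos_iff.2 hp.1

/-- The periodic sequence `p p p ⋯` attached to a Lyndon word `p`. -/
def IsLyndon.periodic {X : Type*} [LinearOrder X] {p : List X} (hp : IsLyndon p) (t : ℕ) : X :=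
  p[t % p.length]'(Nat.mod_lt _ hp.length_pos)

theorem IsLyndon.getElem?_eq_periodic {X : Type*} [LinearOrder X] {p : List X}
    (hp : IsLyndon p) {t : ℕ} (ht : t < p.length) : p[t]? = some (hp.periodic t) := by
  simp only [periodic, Nat.mod_eq_of_lt ht]
  exact List.getElem?_eq_getElem ht

theorem IsLyndon.drop_eq_cons {X : Type*} [LinearOrder X] {p : List X}
    (hp : IsLyndon p) {t : ℕ} (ht : t < p.length) :
    p.drop t = hp.periodic t :: p.drop (t + 1) := by
  rw [List.drop_eq_getElem_cons ht]
  simp [periodic, Nat.mod_eq_of_lt ht]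

theorem IsLyndon.periodic_add {X : Type*} [LinearOrder X] {p : List X} (hp : IsLyndon p)
    (t : ℕ) : hp.periodic (p.length + t) = hp.periodic t := by
  simp [periodic]

theorem IsLyndon.periodic_shift_lt {X : Type*} [LinearOrder X] {p : List X} (hp : IsLyndon p)
    {r : ℕ} (h0 : 0 < r) (hr : r < p.length) :
    ∃ d, (∀ t < d, hp.periodic (r + t) = hp.periodic t) ∧
      hp.periodic (r + d) < hp.periodic d := by
  obtain ⟨d, h1, x, y, hx, hy, hxy⟩ := exists_getElem_lt_of_wlt (hp.suffix_wlt h0 hr) (by simp)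
  have hd : r + d < p.length := by
    rw [List.getElem?_drop] at hx
    exact (List.getElem?_eq_some_iff.1 hx).1
  refine ⟨d, fun t ht => ?_, ?_⟩
  · have := h1 t ht
    rw [List.getElem?_drop, hp.getElem?_eq_periodic (by omega),
      hp.getElem?_eq_periodic (by omega)] at this
    exact Option.some_injective _ this
  · rw [List.getElem?_drop, hp.getElem?_eq_periodic (by omega)] at hx
    rw [hp.getElem?_eq_periodic (by omega)] at hy
    rwa [Option.some_injective _ hx, Option.some_injective _ hy]

theorem IsLyndon.periodic_shift {X : Type*} [LinearOrder X] {p : List X} (hp : IsLyndon p)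
    (s : ℕ) : (∀ t, hp.periodic (s + t) = hp.periodic t) ∨
      ∃ d, (∀ t < d, hp.periodic (s + t) = hp.periodic t) ∧
        hp.periodic (s + d) < hp.periodic d := by
  have hmod : ∀ t, hp.periodic (s + t) = hp.periodic (s % p.length + t) := by
    intro t
    simp [periodic]
  simp only [hmod]
  rcases Nat.eq_zero_or_pos (s % p.length) with h | h
  · exact Or.inl fun t => by rw [h, Nat.zero_add]
  · exact Or.inr (hp.periodic_shift_lt h (Nat.mod_lt _ hp.length_pos))

theorem shCoeff_nil_left {k X : Type*} [Field k] [DecidableEq X] (q : X → X → k) :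
    ∀ b c : List X, shCoeff q [] b c = if b = c then 1 else 0
  | [], [] => by simp [shCoeff]
  | _ :: _, [] => by simp [shCoeff]
  | [], _ :: _ => by simp [shCoeff]
  | y :: b, z :: c => by
    by_cases h : y = z <;> simp [shCoeff, crossFactor, h, shCoeff_nil_left q b c]

theorem shCoeff_cons_right {k X : Type*} [Field k] [DecidableEq X] (q : X → X → k) (x : X) (a b : List X)
    (z : X) (c : List X) :
    shCoeff q (x :: a) b (z :: c) = (if x = z then shCoeff q a b c else 0) +
      (match b with
        | [] => 0
        | y :: b' => if y = z then crossFactor q (x :: a) y * shCoeff q (x :: a) b' c else 0) := by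
  cases b
  · simp only [shCoeff]
    congr
  · simp only [shCoeff]
    congr

/-- The quantum shuffle product is graded by content. -/
theorem coe_eq_add_of_shCoeff_ne_zero {k X : Type*} [Field k] (q : X → X → k) :
    ∀ c a b : List X, shCoeff q a b c ≠ 0 → (c : Multiset X) = a + b := by
  intro c
  induction c with
  | nil =>
    intro a b h
    rw [shCoeff] at h
    obtain ⟨rfl, rfl⟩ := (ite_ne_right_iff.1 h).1
    simp
  | cons z c ih =>
    intro a b h
    cases a with
    | nil =>
      rw [shCoeff_nil_left] at h
      rw [(ite_ne_right_iff.1 h).1]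
      simp
    | cons x a =>
      rw [shCoeff_cons_right] at h
      by_cases h1 : (if x = z then shCoeff q a b c else 0) = 0
      · rw [h1, zero_add] at h
        cases b with
        | nil => simp at h
        | cons y b =>
          simp only [ne_eq, ite_eq_right_iff, not_forall] at h
          obtain ⟨rfl, h⟩ := h
          have := ih _ _ (right_ne_zero_of_mul h)
          rw [← Multiset.cons_coe, this, ← Multiset.cons_coe y b, Multiset.add_cons]
      · obtain ⟨rfl, h2⟩ := ite_ne_right_iff.1 h1
        rw [← Multiset.cons_coe, ih _ _ h2, ← Multiset.cons_coe x a, Multiset.cons_add]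

section MaximalShuffle

variable {k X : Type*} [Field k] [LinearOrder X] (q : X → X → k) {p : List X}

theorem periodic_le_of_take_eq (hp : IsLyndon p) {b : List X}
    (hb : p <+: b ∨ wlt p b) {f : ℕ} (hf : f < p.length) {y : X} {b' : List X}
    (htake : b.take f = p.take f) (hy : b.drop f = y :: b') : hp.periodic f ≤ y := by
  have h1 : b = p.take f ++ y :: b' := by rw [← htake, ← hy, List.take_append_drop]
  have h2 : p = p.take f ++ hp.periodic f :: p.drop (f + 1) := by
    rw [← hp.drop_eq_cons hf, List.take_append_drop]
  rcases hb with ⟨s, rfl⟩ | hb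
  · rw [List.drop_append_of_le_length hf.le, hp.drop_eq_cons hf] at hy
    exact (List.cons_eq_cons.1 hy).1.le
  · rw [h1] at hb
    nth_rw 1 [h2] at hb
    rw [wlt_append_left_iff] at hb
    rcases hb with h | ⟨h, -⟩
    · exact h.le
    · exact h.le

theorem take_succ_eq_of_drop_eq (hp : IsLyndon p) {b : List X} {f : ℕ} (hf : f < p.length)
    (htake : b.take f = p.take f) {b' : List X} (hy : b.drop f = hp.periodic f :: b') :
    b.take (f + 1) = p.take (f + 1) ∧ b.drop (f + 1) = b' := by
  constructor
  · rw [List.take_add, List.take_add, htake, hy, hp.drop_eq_cons hf]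
    simp
  · rw [← List.drop_drop, hy]
    simp

/-- Every shuffle of a Lyndon word `p` with a word `b` at least `p` (or extending `p`)
either starts with `p` or is greater than every word starting with `p`. -/
theorem prefix_or_wlt_of_shCoeff_ne_zero (hp : IsLyndon p) {b : List X}
    (hb : p <+: b ∨ wlt p b) (b₀ : List X) (m : ℕ) :
    ∀ (e f : ℕ) (c : List X), e + f + m = p.length → ReadsPrefix hp.periodic 0 e f →
      b.take f = p.take f → shCoeff q (p.drop e) (b.drop f) c ≠ 0 →
      p.drop (e + f) <+: c ∨ wlt (p.drop (e + f) ++ b₀) c := by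
  induction m with
  | zero =>
    intro e f c hm _ _ _
    left
    rw [show e + f = p.length by omega, List.drop_length]
    exact List.nil_prefix
  | succ m ih =>
    intro e f c hm H htake hne
    have hle := ReadsPrefix.next_le hp.periodic_shift _ 0 e f rfl H
    rw [Nat.zero_add] at hle
    rw [hp.drop_eq_cons (t := e) (by omega)] at hne
    rw [hp.drop_eq_cons (t := e + f) (by omega)]
    have step : ∀ (z : X) (c' : List X), hp.periodic (e + f) ≤ z →
        (hp.periodic (e + f) = z →
          p.drop (e + f + 1) <+: c' ∨ wlt (p.drop (e + f + 1) ++ b₀) c') →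
        (hp.periodic (e + f) :: p.drop (e + f + 1) <+: z :: c' ∨
          wlt (hp.periodic (e + f) :: p.drop (e + f + 1) ++ b₀) (z :: c')) := by
      intro z c' hz himp
      rcases hz.lt_or_eq with hz | hz
      · exact Or.inr (Or.inl hz)
      · rcases himp hz with h | h
        · exact Or.inl (List.cons_prefix_cons.2 ⟨hz, h⟩)
        · exact Or.inr (Or.inr ⟨hz, h⟩)
    cases c with
    | nil => simp [shCoeff] at hne
    | cons z c =>
      rw [shCoeff_cons_right] at hne
      by_cases h1 : (if hp.periodic e = z then shCoeff q (p.drop (e + 1)) (b.drop f) c else 0) = 0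
      · rw [h1, zero_add] at hne
        cases hbf : b.drop f with
        | nil => simp [hbf] at hne
        | cons y b' =>
          simp only [hbf, ne_eq, ite_eq_right_iff, not_forall] at hne
          obtain ⟨rfl, hne⟩ := hne
          have hne := right_ne_zero_of_mul hne
          have hy := periodic_le_of_take_eq hp hb (by omega) htake hbf
          refine step _ _ (hle.2.trans hy) fun heq => ?_
          have hyf : hp.periodic f = y := le_antisymm hy (heq ▸ hle.2)
          obtain ⟨h2, h3⟩ := take_succ_eq_of_drop_eq hp (by omega) htake (hyf ▸ hbf)
          rw [← hp.drop_eq_cons (by omega), ← h3] at hne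
          exact ih e (f + 1) c (by omega) (H.right (by rw [Nat.zero_add, hyf, heq])) h2 hne
      · obtain ⟨rfl, hne'⟩ := ite_ne_right_iff.1 h1
        refine step _ _ hle.1 fun heq => ?_
        have := ih (e + 1) f c (by omega) (H.left (by rw [Nat.zero_add, heq])) htake hne'
        rwa [show e + 1 + f = e + f + 1 by omega] at this

theorem shCoeff_drop_append (hp : IsLyndon p) {b : List X}
    (hb : p <+: b ∨ wlt p b) (c : List X) (m : ℕ) :
    ∀ e f : ℕ, e + f + m = p.length → ReadsPrefix hp.periodic 0 e f →
      b.take f = p.take f →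
      shCoeff q (p.drop e) (b.drop f) (p.drop (e + f) ++ c) =
        (if f = 0 then shCoeff q [] b c else 0) +
        (if e = 0 ∧ p <+: b then
          ((p.drop f).map (crossFactor q p)).prod * shCoeff q p (b.drop p.length) c else 0) := by
  have hpos := hp.length_pos
  induction m with
  | zero =>
    intro e f hm H htake
    rw [show e + f = p.length by omega, List.drop_length, List.nil_append]
    rcases Nat.eq_zero_or_pos e with rfl | he
    · obtain rfl : f = p.length := by omega
      have : p <+: b := by
        rw [List.prefix_iff_eq_take, htake, List.take_length]
      simp [this, hp.1]
    · rcases Nat.eq_zero_or_pos f with rfl | hf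
      · obtain rfl : e = p.length := by omega
        simp [hp.1]
      · exact absurd H (ReadsPrefix.not_full_period hp.periodic_add hp.periodic_shift
          (hp.periodic_shift_lt he (by omega)) (by omega))
  | succ m ih =>
    intro e f hm H htake
    have hle := ReadsPrefix.next_le hp.periodic_shift _ 0 e f rfl H
    rw [Nat.zero_add] at hle
    rw [hp.drop_eq_cons (t := e) (by omega), hp.drop_eq_cons (t := e + f) (by omega),
      List.cons_append, shCoeff_cons_right, ← hp.drop_eq_cons (t := e) (by omega)]
    have hfirst : (if hp.periodic e = hp.periodic (e + f) then
          shCoeff q (p.drop (e + 1)) (b.drop f) (p.drop (e + f + 1) ++ c) else 0) =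
        if f = 0 then shCoeff q [] b c else 0 := by
      split_ifs with h1 h2 h2
      · have := ih (e + 1) f (by omega) (H.left (by rw [Nat.zero_add, h1])) htake
        rw [show e + 1 + f = e + f + 1 by omega] at this
        subst h2
        simpa using this
      · have := ih (e + 1) f (by omega) (H.left (by rw [Nat.zero_add, h1])) htake
        rw [show e + 1 + f = e + f + 1 by omega] at this
        simp [this, h2]
      · exact absurd (by rw [h2, Nat.add_zero]) h1
      · rfl
    rw [hfirst]
    congr 1
    cases hbf : b.drop f with
    | nil =>
      have : ¬ p <+: b := by
        rintro ⟨s, rfl⟩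
        rw [List.drop_eq_nil_iff, List.length_append] at hbf
        omega
      simp [this]
    | cons y b' =>
      have hy := periodic_le_of_take_eq hp hb (by omega) htake hbf
      simp only
      split_ifs with h1 h2 h2
      · subst h1
        have hyf : hp.periodic f = hp.periodic (e + f) := le_antisymm hy hle.2
        obtain ⟨h3, h4⟩ := take_succ_eq_of_drop_eq hp (by omega) htake (hyf ▸ hbf)
        rw [← h4, Nat.add_assoc, ih e (f + 1) (by omega) (H.right (by rw [Nat.zero_add, hyf])) h3]
        obtain ⟨rfl, h2⟩ := h2
        rw [hp.drop_eq_cons (t := f) (by omega)]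
        simp [h2, hyf, mul_assoc]
      · subst h1
        have hyf : hp.periodic f = hp.periodic (e + f) := le_antisymm hy hle.2
        obtain ⟨h3, h4⟩ := take_succ_eq_of_drop_eq hp (by omega) htake (hyf ▸ hbf)
        rw [← h4, Nat.add_assoc, ih e (f + 1) (by omega) (H.right (by rw [Nat.zero_add, hyf])) h3]
        simp [h2]
      · obtain ⟨rfl, s, rfl⟩ := h2
        rw [List.drop_append_of_le_length (by omega), hp.drop_eq_cons (by omega)] at hbf
        exact absurd (by rw [Nat.zero_add]; exact (List.cons_eq_cons.1 hbf).1.symm) h1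
      · rfl

end MaximalShuffle

theorem suffix_wlt_flatten {X : Type*} [LinearOrder X] {p : List X} (hp : IsLyndon p) :
    ∀ (bs : List (List X)), (∀ r ∈ bs, p = r ∨ wlt p r) →
    ∀ s : List X, s ≠ [] → s <:+ p → (s = p → ∀ r ∈ bs, wlt p r) → wlt s bs.flatten
  | [], _, s, hs, _, _ => by
    cases s with
    | nil => exact absurd rfl hs
    | cons x s => simp [wlt]
  | r :: bs, hbs, s, hs, hsuf, hstrict => by
    have hsr : wlt s r := by
      by_cases h : s = p
      · exact h ▸ hstrict h r (by simp)
      · obtain ⟨u, hu⟩ := id hsuf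
        have hsp : wlt s p := hp.2 u s (by rintro rfl; exact h hu) hs hu.symm
        rcases hbs r (by simp) with rfl | h
        · exact hsp
        · exact wlt_trans hsp h
    rw [List.flatten_cons]
    rcases wlt_append_or bs.flatten hsr with h | ⟨s', hs', rfl⟩
    · exact h
    · rw [wlt_append_left_iff]
      refine suffix_wlt_flatten hp bs (fun r hr => hbs r (by simp [hr])) s' hs'
        ((List.suffix_append _ _).trans hsuf) fun h => ?_
      subst h
      have := hsuf.eq_of_length_le (by simp)
      exact fun r' hr' => hstrict this r' (by simp [hr'])

theorem wlt_flatten {X : Type*} [LinearOrder X] {p : List X} (hp : IsLyndon p)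
    {bs : List (List X)} (hbs : ∀ r ∈ bs, wlt p r) : wlt p bs.flatten :=
  suffix_wlt_flatten hp bs (fun r hr => Or.inr (hbs r hr)) p hp.1 List.suffix_rfl fun _ => hbs

theorem not_wlt_of_prefix {X : Type*} [LinearOrder X] {p b : List X} (h : p <+: b) :
    ¬ wlt p b := by
  obtain ⟨s, rfl⟩ := h
  have := wlt_append_left_iff p [] s
  rw [List.append_nil] at this
  rw [this]
  simp [wlt]

theorem shCoeff_append_left {k X : Type*} [Field k] [LinearOrder X] (q : X → X → k)
    {p : List X} (hp : IsLyndon p) {b : List X} (hb : p <+: b ∨ wlt p b) (c : List X) :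
    shCoeff q p b (p ++ c) = (if b = c then 1 else 0) + if p <+: b then
      (p.map (crossFactor q p)).prod * shCoeff q p (b.drop p.length) c else 0 := by
  have := shCoeff_drop_append q hp hb c p.length 0 0 (by simp) .zero (by simp)
  rw [shCoeff_nil_left] at this
  simpa using this

/-- Shuffling a Lyndon word `p` into a word `b` at least the concatenation `b₀` of a sorted list
of Lyndon words that are at least `p` only produces words at least `p ++ b₀`. -/
theorem eq_or_wlt_of_shCoeff_flatten_ne_zero {k X : Type*} [Field k] [LinearOrder X]
    (q : X → X → k) {p : List X} (hp : IsLyndon p) :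
    ∀ (bs : List (List X)), bs.Pairwise (fun r s => r = s ∨ wlt r s) →
    (∀ r ∈ bs, p = r ∨ wlt p r) → ∀ b c : List X, bs.flatten = b ∨ wlt bs.flatten b →
    b.length = bs.flatten.length → shCoeff q p b c ≠ 0 →
    (c = p ++ bs.flatten ∧ b = bs.flatten) ∨ wlt (p ++ bs.flatten) c := by
  intro bs
  induction bs with
  | nil =>
    intro _ _ b c _ hlen hne
    obtain rfl : b = [] := List.eq_nil_of_length_eq_zero (by simpa using hlen)
    rcases prefix_or_wlt_of_shCoeff_ne_zero q hp (b := []) (Or.inr (wlt_flatten hp (bs := [])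
      (by simp))) [] p.length 0 0 c (by simp) .zero (by simp) (by simpa using hne) with h | h
    · left
      have := congrArg Multiset.card (coe_eq_add_of_shCoeff_ne_zero q _ _ _ hne)
      rw [Nat.add_zero, List.drop_zero] at h
      simp only [Multiset.coe_add, Multiset.coe_card, List.append_nil] at this
      simp [h.eq_of_length this.symm]
    · right
      simpa using h
  | cons r bs ih =>
    intro hpw hbs b c hge hlen hne
    rw [List.pairwise_cons] at hpw
    have hb : (p = r ∧ p <+: b) ∨ wlt p b := by
      rcases hbs r (by simp) with rfl | h
      · rcases hge with rfl | hge
        · exact Or.inl ⟨rfl, by simp⟩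
        · by_cases hpb : p <+: b
          · exact Or.inl ⟨rfl, hpb⟩
          · right
            rcases wlt_trichotomy p b with h | rfl | h
            · exact h
            · exact absurd List.prefix_rfl hpb
            · exfalso
              rcases wlt_append_or bs.flatten h with h | ⟨s, -, rfl⟩
              · exact wlt_irrefl _ (wlt_trans h hge)
              · exact hpb (List.prefix_append _ _)
      · have : wlt p (r :: bs).flatten := by
          refine wlt_flatten hp fun s hs => ?_
          rcases List.mem_cons.1 hs with rfl | hs
          · exact h
          · rcases hpw.1 s hs with rfl | h'
            · exact h
            · exact wlt_trans h h'
        rcases hge with rfl | hge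
        · exact Or.inr this
        · exact Or.inr (wlt_trans this hge)
    rcases prefix_or_wlt_of_shCoeff_ne_zero q hp (hb.imp_left And.right) (r :: bs).flatten
      p.length 0 0 c (by simp) .zero (by simp) (by simpa using hne) with h | h
    · rw [Nat.add_zero, List.drop_zero] at h
      obtain ⟨c, rfl⟩ := h
      by_cases hbc : b = c
      · subst hbc
        rcases hge with h | h
        · exact Or.inl ⟨by rw [h], h.symm⟩
        · exact Or.inr ((wlt_append_left_iff _ _ _).2 h)
      · rw [shCoeff_append_left q hp (hb.imp_left And.right), if_neg hbc, zero_add] at hne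
        obtain ⟨hpb, hne⟩ := ite_ne_right_iff.1 hne
        rcases hb with ⟨rfl, -⟩ | hb
        · obtain ⟨b, rfl⟩ := hpb
          rw [List.drop_left] at hne
          rw [List.flatten_cons] at hge hlen ⊢
          rw [List.append_cancel_left_eq, wlt_append_left_iff] at hge
          have := ih hpw.2 (fun s hs => hbs s (by simp [hs])) b c hge (by simpa using hlen)
            (right_ne_zero_of_mul hne)
          rw [List.append_cancel_left_eq, List.append_cancel_left_eq, wlt_append_left_iff]
          exact this
        · exact absurd hb (not_wlt_of_prefix hpb)
    · rw [Nat.add_zero, List.drop_zero] at h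
      exact Or.inr h

theorem Qof_eq_prod_crossFactor {k X : Type*} [Field k] (q : X → X → k) (p : List X) :
    Qof q p = (p.map (crossFactor q p)).prod := by
  rw [Qof, Finset.prod_comm]
  have h : ∀ g : X → k, (p.map g).prod = ∏ i : Fin p.length, g (p.get i) := by
    intro g
    conv_lhs => rw [← List.ofFn_get p, List.map_ofFn, List.prod_ofFn]
    simp
  simp only [crossFactor, h]

theorem shCoeff_replicate_flatten {k X : Type*} [Field k] [LinearOrder X] (q : X → X → k)
    {p : List X} (hp : IsLyndon p) {bs : List (List X)} (hbs : ∀ r ∈ bs, wlt p r) (n : ℕ) :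
    shCoeff q p (List.replicate n p ++ bs).flatten
      (p ++ (List.replicate n p ++ bs).flatten) = ∑ i ∈ Finset.range (n + 1), Qof q p ^ i := by
  induction n with
  | zero =>
    have h := wlt_flatten hp hbs
    rw [List.replicate_zero, List.nil_append, shCoeff_append_left q hp (Or.inr h),
      if_neg fun h' => not_wlt_of_prefix h' h]
    simp
  | succ n ih =>
    rw [List.replicate_succ, List.cons_append, List.flatten_cons,
      shCoeff_append_left q hp (Or.inl (List.prefix_append _ _)), if_pos rfl,
      if_pos (List.prefix_append _ _), List.drop_left, ih, ← Qof_eq_prod_crossFactor,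
      Finset.sum_range_succ' _ (n + 1), Finset.mul_sum, add_comm]
    simp [pow_succ']

theorem XOf_cons_apply {k X : Type*} [Field k] (q : X → X → k) (p : List X)
    (fs : List (List X)) (c : List X) :
    XOf q (p :: fs) c = (XOf q fs).sum fun b x => x * shCoeff q p b c := by
  have h : XOf q (p :: fs) = qShMul q (Finsupp.single p 1) (XOf q fs) := rfl
  rw [h, qShMul, Finsupp.sum_single_index (by simp), Finsupp.sum, Finsupp.finsetSum_apply]
  simp [Finsupp.sum, qMulWord_apply]

/-- The words occurring in a product of a sorted list of Lyndon words are permutations of the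
concatenation that are at least the concatenation. -/
theorem eq_or_wlt_of_XOf_ne_zero {k X : Type*} [Field k] [LinearOrder X] (q : X → X → k) :
    ∀ fs : List (List X), (∀ p ∈ fs, IsLyndon p) →
    fs.Pairwise (fun r s => r = s ∨ wlt r s) → ∀ c : List X, XOf q fs c ≠ 0 →
    (c : Multiset X) = fs.flatten ∧ (c = fs.flatten ∨ wlt fs.flatten c)
  | [], _, _, c, h => by
    have h : (Finsupp.single [] 1 : List X →₀ k) c ≠ 0 := h
    rw [Finsupp.single_apply] at h
    simp [← (ite_ne_right_iff.1 h).1]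
  | p :: fs, hly, hpw, c, h => by
    rw [XOf_cons_apply] at h
    obtain ⟨b, hb, hne⟩ := Finset.exists_ne_zero_of_sum_ne_zero h
    rw [List.pairwise_cons] at hpw
    obtain ⟨h1, h2⟩ := eq_or_wlt_of_XOf_ne_zero q fs (fun r hr => hly r (by simp [hr])) hpw.2 b
      (left_ne_zero_of_mul hne)
    have hne := right_ne_zero_of_mul hne
    constructor
    · rw [coe_eq_add_of_shCoeff_ne_zero q _ _ _ hne, h1, List.flatten_cons, Multiset.coe_add]
    · exact (eq_or_wlt_of_shCoeff_flatten_ne_zero q (hly p (by simp)) fs hpw.2 hpw.1 b c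
        (h2.imp_left Eq.symm) (by simpa using congrArg Multiset.card h1) hne).imp_left And.left

theorem XOf_cons_apply_flatten {k X : Type*} [Field k] [LinearOrder X] (q : X → X → k)
    {p : List X} {fs : List (List X)} (hly : ∀ r ∈ p :: fs, IsLyndon r)
    (hpw : (p :: fs).Pairwise (fun r s => r = s ∨ wlt r s)) :
    XOf q (p :: fs) (p ++ fs.flatten) =
      XOf q fs fs.flatten * shCoeff q p fs.flatten (p ++ fs.flatten) := by
  rw [XOf_cons_apply, Finsupp.sum]
  rw [List.pairwise_cons] at hpw
  apply Finset.sum_eq_single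
  · intro b hb hne
    by_contra h
    obtain ⟨h1, h2⟩ := eq_or_wlt_of_XOf_ne_zero q fs (fun r hr => hly r (by simp [hr])) hpw.2 b
      (left_ne_zero_of_mul h)
    rcases eq_or_wlt_of_shCoeff_flatten_ne_zero q (hly p (by simp)) fs hpw.2 hpw.1 b _
        (h2.imp_left Eq.symm) (by simpa using congrArg Multiset.card h1)
        (right_ne_zero_of_mul h) with h3 | h3
    · exact hne h3.2
    · exact wlt_irrefl _ h3
  · intro h
    rw [Finsupp.notMem_support_iff.1 h, zero_mul]

theorem pairwise_flatMap_replicate {X : Type*} [LinearOrder X] {L : List (List X × ℕ)}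
    (hL : L.Pairwise fun a b => wlt a.1 b.1) :
    (L.flatMap fun pn => List.replicate pn.2 pn.1).Pairwise (fun r s => r = s ∨ wlt r s) := by
  rw [List.pairwise_flatMap]
  refine ⟨fun pn _ => ?_, hL.imp fun {a b} h x hx y hy => ?_⟩
  · rw [List.pairwise_replicate]
    simp
  · rw [List.eq_of_mem_replicate hx, List.eq_of_mem_replicate hy]
    exact Or.inr h

theorem XOf_apply_flatten {k X : Type*} [Field k] [LinearOrder X] (q : X → X → k) :
    ∀ L : List (List X × ℕ), (∀ pn ∈ L, IsLyndon pn.1) →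
    (L.Pairwise fun a b => wlt a.1 b.1) →
    XOf q (L.flatMap fun pn => List.replicate pn.2 pn.1)
      (L.flatMap fun pn => List.replicate pn.2 pn.1).flatten =
      (L.map fun pn => qFact pn.2 (Qof q pn.1)).prod
  | [], _, _ => by simp [XOf]
  | (p, n) :: L, hly, hpw => by
    have hp : IsLyndon p := hly (p, n) (by simp)
    have hrec := XOf_apply_flatten q L (fun pn hpn => hly pn (by simp [hpn]))
      (List.pairwise_cons.1 hpw).2
    induction n with
    | zero => simpa [qFact] using hrec
    | succ n ih =>
      have hly' : ∀ pn ∈ (p, n) :: L, IsLyndon pn.1 := by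
        intro pn hpn
        rcases List.mem_cons.1 hpn with rfl | h
        · exact hp
        · exact hly pn (by simp [h])
      have hpw' : ((p, n) :: L).Pairwise fun a b => wlt a.1 b.1 := by
        rw [List.pairwise_cons] at hpw ⊢
        exact hpw
      have ih := ih hly' hpw'
      rw [List.flatMap_cons, List.map_cons, List.prod_cons] at ih ⊢
      have hpw2 := pairwise_flatMap_replicate hpw
      have hmem : ∀ r ∈ L.flatMap (fun pn => List.replicate pn.2 pn.1), ∃ pn ∈ L, r = pn.1 := by
        intro r hr
        obtain ⟨pn, hpn, hr⟩ := List.mem_flatMap.1 hr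
        exact ⟨pn, hpn, List.eq_of_mem_replicate hr⟩
      rw [List.flatMap_cons] at hpw2
      simp only [List.replicate_succ, List.cons_append] at hpw2 ih ⊢
      rw [List.flatten_cons, XOf_cons_apply_flatten q _ hpw2, ih, shCoeff_replicate_flatten q hp]
      · rw [qFact, qFact, Finset.prod_range_succ]
        ring
      · intro r hr
        obtain ⟨pn, hpn, rfl⟩ := hmem r hr
        exact (List.pairwise_cons.1 hpw).1 pn hpn
      · intro r hr
        rcases List.mem_cons.1 hr with rfl | hr
        · exact hp
        · rcases List.mem_append.1 hr with hr | hr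
          · rw [List.eq_of_mem_replicate hr]
            exact hp
          · obtain ⟨pn, hpn, rfl⟩ := hmem r hr
            exact hly pn (by simp [hpn])

theorem finite_coe_eq {X : Type*} (u : Multiset X) : Finite {a : List X // (a : Multiset X) = u} := by
  induction u using Quotient.inductionOn with
  | _ l =>
    refine Set.Finite.to_subtype ((List.finite_toSet l.permutations).subset fun a ha => ?_)
    exact List.mem_permutations.2 (Multiset.coe_eq_coe.1 ha)

/-- A family indexed by the words of content `u` that is triangular for `wlt`, with nonzero
diagonal, is a basis of the span of those words. -/
theorem linearIndependent_and_span_of_triangular {k X : Type*} [Field k] [LinearOrder X]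
    (u : Multiset X) (v : List X → List X →₀ k)
    (htri : ∀ a c : List X, v a c ≠ 0 → (c : Multiset X) = a ∧ (c = a ∨ wlt a c))
    (hdiag : ∀ a : List X, (a : Multiset X) = u → v a a ≠ 0) :
    LinearIndependent k (fun a : {a : List X // (a : Multiset X) = u} => v a.1) ∧
      Submodule.span k (Set.range fun a : {a : List X // (a : Multiset X) = u} => v a.1) =
        Submodule.span k (Set.range fun b : {b : List X // (b : Multiset X) = u} =>
          Finsupp.single b.1 (1 : k)) := by
  have := finite_coe_eq u
  let r : {a : List X // (a : Multiset X) = u} → {a : List X // (a : Multiset X) = u} → Prop :=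
    fun a b => wlt a.1 b.1
  have : Std.Irrefl r := ⟨fun a => wlt_irrefl a.1⟩
  have : IsTrans _ r := ⟨fun a b c => wlt_trans⟩
  have hwf : WellFounded r := Finite.wellFounded_of_trans_of_irrefl r
  have hwf' : WellFounded (Function.swap r) := Finite.wellFounded_of_trans_of_irrefl _
  constructor
  · rw [linearIndependent_iff']
    intro s g hg a
    induction a using hwf.induction with
    | _ a ih =>
      intro ha
      have h0 := DFunLike.congr_fun hg a.1
      rw [Finsupp.finsetSum_apply, Finset.sum_eq_single a] at h0
      · simpa [hdiag a.1 a.2] using h0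
      · intro b hb hba
        by_contra hne
        rw [Finsupp.smul_apply, smul_eq_mul] at hne
        rcases (htri _ _ (right_ne_zero_of_mul hne)).2 with h | h
        · exact hba (Subtype.ext h.symm)
        · exact left_ne_zero_of_mul hne (ih b h hb)
      · exact fun h => absurd ha h
  · apply le_antisymm
    · rw [Submodule.span_le]
      rintro _ ⟨a, rfl⟩
      simp only [SetLike.mem_coe]
      rw [← Finsupp.sum_single (v a.1)]
      refine Submodule.sum_mem _ fun c hc => ?_
      rw [← mul_one (v a.1 c), ← smul_eq_mul, ← Finsupp.smul_single]
      have hc := (htri _ _ (Finsupp.mem_support_iff.1 hc)).1.trans a.2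
      exact Submodule.smul_mem _ _ (Submodule.subset_span ⟨⟨c, hc⟩, rfl⟩)
    · rw [Submodule.span_le]
      rintro _ ⟨a, rfl⟩
      simp only [SetLike.mem_coe]
      induction a using hwf'.induction with
      | _ a ih =>
        have h1 := Finsupp.single_add_erase a.1 (v a.1)
        have h2 : (Finsupp.single a.1 1 : List X →₀ k) =
            (v a.1 a.1)⁻¹ • (v a.1 - (v a.1).erase a.1) := by
          rw [eq_inv_smul_iff₀ (hdiag a.1 a.2), Finsupp.smul_single, smul_eq_mul, mul_one]
          exact eq_sub_of_add_eq h1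
        rw [h2]
        refine Submodule.smul_mem _ _ (Submodule.sub_mem _ (Submodule.subset_span ⟨a, rfl⟩) ?_)
        rw [← Finsupp.sum_single ((v a.1).erase a.1)]
        refine Submodule.sum_mem _ fun c hc => ?_
        rw [Finsupp.support_erase, Finset.mem_erase, Finsupp.mem_support_iff] at hc
        rw [← mul_one (Finsupp.erase a.1 (v a.1) c), ← smul_eq_mul, ← Finsupp.smul_single]
        obtain ⟨h3, h4⟩ := htri _ _ hc.2
        exact Submodule.smul_mem _ _ (ih ⟨c, h3.trans a.2⟩ (h4.resolve_left hc.1))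

/-- In the quantum shuffle algebra with diagonal braiding, given for each word
`a` its Lyndon factorization `a = p₁^{n₁} ⋯ p_s^{n_s}` (encoded by
`F a = [(p₁,n₁),…,(p_s,n_s)]` with `p₁ < ⋯ < p_s` Lyndon), the elements
`X_a = v_{p₁}^{·n₁} · ⋯ · v_{p_s}^{·n_s}` satisfy a triangular change of
basis: `X_a = Σ_{b ≥ a} α_{ab} v_b` with `α_{aa} = Π_j [n_j]_{Q_j}!`; and if
all these leading coefficients are nonzero, the `X_a` for `a ∈ S(u)` form a
basis of the content-graded component `T(V)(u)`. -/
theorem quantum_shuffle_lyndon_basis {k X : Type*} [Field k] [LinearOrder X]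
    (q : X → X → k) (hq : ∀ i j, q i j ≠ 0)
    (F : List X → List (List X × ℕ))
    (hjoin : ∀ a : List X,
      (((F a).flatMap fun pn => List.replicate pn.2 pn.1)).flatten = a)
    (hly : ∀ a : List X, ∀ pn ∈ F a, IsLyndon pn.1)
    (hpos : ∀ a : List X, ∀ pn ∈ F a, 0 < pn.2)
    (hsorted : ∀ a : List X, ((F a).map Prod.fst).Chain' wlt) :
    (∀ a : List X, ∀ b ∈ (XOf q ((F a).flatMap fun pn =>
        List.replicate pn.2 pn.1)).support, ¬ wlt b a) ∧
    (∀ a : List X,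
      (XOf q ((F a).flatMap fun pn => List.replicate pn.2 pn.1)) a =
        ((F a).map fun pn => qFact pn.2 (Qof q pn.1)).prod) ∧
    (∀ u : Multiset X,
      (∀ a : List X, (a : Multiset X) = u →
        ((F a).map fun pn => qFact pn.2 (Qof q pn.1)).prod ≠ 0) →
      LinearIndependent k (fun a : {a : List X // (a : Multiset X) = u} =>
        XOf q ((F a.1).flatMap fun pn => List.replicate pn.2 pn.1)) ∧
      Submodule.span k (Set.range fun a : {a : List X // (a : Multiset X) = u} =>
          XOf q ((F a.1).flatMap fun pn => List.replicate pn.2 pn.1)) =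
        Submodule.span k (Set.range fun b : {b : List X // (b : Multiset X) = u} =>
          Finsupp.single b.1 (1 : k))) := by
  have hpw : ∀ a : List X, (F a).Pairwise fun r s => wlt r.1 s.1 := by
    intro a
    have : IsTrans (List X) wlt := ⟨fun _ _ _ => wlt_trans⟩
    exact List.pairwise_map.1 (List.isChain_iff_pairwise.1 (hsorted a))
  have hlyndon : ∀ a : List X, ∀ p ∈ (F a).flatMap (fun pn => List.replicate pn.2 pn.1),
      IsLyndon p := by
    intro a p hp
    obtain ⟨pn, hpn, hp⟩ := List.mem_flatMap.1 hp
    rw [List.eq_of_mem_replicate hp]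
    exact hly a pn hpn
  have htri : ∀ a c : List X, XOf q ((F a).flatMap fun pn => List.replicate pn.2 pn.1) c ≠ 0 →
      (c : Multiset X) = a ∧ (c = a ∨ wlt a c) := by
    intro a c h
    have := eq_or_wlt_of_XOf_ne_zero q _ (hlyndon a) (pairwise_flatMap_replicate (hpw a)) c h
    rwa [hjoin a] at this
  have hdiag : ∀ a : List X, XOf q ((F a).flatMap fun pn => List.replicate pn.2 pn.1) a =
      ((F a).map fun pn => qFact pn.2 (Qof q pn.1)).prod := by
    intro a
    have := XOf_apply_flatten q (F a) (hly a) (hpw a)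
    rwa [hjoin a] at this
  refine ⟨fun a b hb hlt => ?_, hdiag, fun u hu => ?_⟩
  · rcases (htri a b (Finsupp.mem_support_iff.1 hb)).2 with rfl | h
    · exact wlt_irrefl _ hlt
    · exact wlt_irrefl _ (wlt_trans h hlt)
  · obtain ⟨v, hv⟩ : ∃ v : List X → List X →₀ k,
        ∀ a, XOf q ((F a).flatMap fun pn => List.replicate pn.2 pn.1) = v a := ⟨_, fun _ => rfl⟩
    simp only [hv] at htri hdiag ⊢
    exact linearIndependent_and_span_of_triangular u v htri fun a ha => hdiag a ▸ hu a ha
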